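/- Let 0 < α, γ ≤ 1 with α + γ > 1. Let f : [0,1] → ℝ be γ-Hölder continuous and let F ∈ C¹([0,1] × ℝ) be such that the map s ↦ ∂ₓF(s, f(s)) is α-Hölder continuous on [0,1]. For t ∈ [0,1] let I(t) denote the Young integral of s ↦ ∂ₓF(s, f(s)) against f, i.e. the limit, as the mesh tends to zero, of the Riemann sums Σ_{i=0}^{n−1} ∂ₓF(t_i, f(t_i))(f(t_{i+1}) − f(t_i)) over partitions 0 = t₀ < ⋯ < t_n = t (which exists since α + γ > 1). Then for every t ∈ [0,1]: F(t, f(t)) = F(0, f(0)) + I(t) + ∫₀ᵗ ∂ₛF(s, f(s)) ds. -/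

import Mathlib

open Set

/-- Left-endpoint Riemann sum of `φ` against the increments of `g` along a partition
`pt : Fin (n+1) → ℝ`. -/
def riemannSum (φ g : ℝ → ℝ) (n : ℕ) (pt : Fin (n + 1) → ℝ) : ℝ :=
  ∑ i : Fin n, φ (pt i.castSucc) * (g (pt i.succ) - g (pt i.castSucc))

lemma yi_step (F : ℝ × ℝ → ℝ) (hF : ContDiff ℝ 1 F) (a b A B u v x y : ℝ) (huv : u ≤ v)
    (h1 : ∀ z ∈ Set.uIcc x y, |fderiv ℝ F (u, z) (0, 1) - a| ≤ A)
    (h2 : ∀ w ∈ Set.Icc u v, |fderiv ℝ F (w, y) (1, 0) - b| ≤ B) :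
    |F (v, y) - F (u, x) - a * (y - x) - b * (v - u)| ≤ A * |y - x| + B * (v - u) := by
  have hd : ∀ p, HasFDerivAt F (fderiv ℝ F p) p := fun p =>
    ((hF.differentiable one_ne_zero) p).hasFDerivAt
  have e1 : |(F (u, y) - a * y) - (F (u, x) - a * x)| ≤ A * |y - x| := by
    have := Convex.norm_image_sub_le_of_norm_hasDerivWithin_le (𝕜 := ℝ)
      (f := fun z => F (u, z) - a * z) (f' := fun z => fderiv ℝ F (u, z) (0, 1) - a)
      (s := Set.uIcc x y) (C := A) (x := x) (y := y) (fun z _ => by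
        have h0 : HasDerivAt (fun z : ℝ => ((u, z) : ℝ × ℝ)) (0, 1) z :=
          (hasDerivAt_const z u).prodMk (hasDerivAt_id z)
        have h3 := (hd (u, z)).comp_hasDerivAt z h0
        have h4 := (hasDerivAt_id z).const_mul a
        rw [mul_one] at h4
        exact (h3.sub h4).hasDerivWithinAt) (fun z hz => h1 z hz) (convex_uIcc x y)
      Set.left_mem_uIcc Set.right_mem_uIcc
    simpa using this
  have e2 : |(F (v, y) - b * v) - (F (u, y) - b * u)| ≤ B * |v - u| := by
    have := Convex.norm_image_sub_le_of_norm_hasDerivWithin_le (𝕜 := ℝ)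
      (f := fun z => F (z, y) - b * z) (f' := fun z => fderiv ℝ F (z, y) (1, 0) - b)
      (s := Set.Icc u v) (C := B) (x := u) (y := v) (fun z _ => by
        have h0 : HasDerivAt (fun z : ℝ => ((z, y) : ℝ × ℝ)) (1, 0) z :=
          (hasDerivAt_id z).prodMk (hasDerivAt_const z y)
        have h3 := (hd (z, y)).comp_hasDerivAt z h0
        have h4 := (hasDerivAt_id z).const_mul b
        rw [mul_one] at h4
        exact (h3.sub h4).hasDerivWithinAt) (fun z hz => h2 z hz) (convex_Icc u v)
      (Set.left_mem_Icc.2 huv) (Set.right_mem_Icc.2 huv)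
    simpa using this
  rw [abs_of_nonneg (sub_nonneg.2 huv)] at e2
  have : F (v, y) - F (u, x) - a * (y - x) - b * (v - u)
    = ((F (v, y) - b * v) - (F (u, y) - b * u)) + ((F (u, y) - a * y) - (F (u, x) - a * x)) := by
    ring
  rw [this]
  exact (abs_add_le _ _).trans (by linarith)

lemma yi_chain (F : ℝ × ℝ → ℝ) (hF : ContDiff ℝ 1 F) (f : ℝ → ℝ) (a b A B s t d : ℝ)
    (hf : ContinuousOn f (Set.Icc s t))
    (h1 : ∀ u ∈ Set.Icc s t, ∀ z, |z - f u| ≤ d → |fderiv ℝ F (u, z) (0, 1) - a| ≤ A)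
    (h2 : ∀ u ∈ Set.Icc s t, ∀ v ∈ Set.Icc s t, |fderiv ℝ F (u, f v) (1, 0) - b| ≤ B)
    (m : ℕ) : ∀ u ∈ Set.Icc s t, |f t - f u| ≤ (m + 1) * d →
    |F (t, f t) - F (u, f u) - a * (f t - f u) - b * (t - u)|
      ≤ A * |f t - f u| + B * (t - u) := by
  have key : ∀ u ∈ Set.Icc s t, ∀ v ∈ Set.Icc s t, u ≤ v → |f v - f u| ≤ d →
      |F (v, f v) - F (u, f u) - a * (f v - f u) - b * (v - u)|
      ≤ A * |f v - f u| + B * (v - u) := by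
    intro u hu v hv huv hd
    refine yi_step F hF a b A B u v (f u) (f v) huv (fun z hz => h1 u hu z ?_)
      (fun w hw => h2 w ⟨hu.1.trans hw.1, hw.2.trans hv.2⟩ v hv)
    exact (Set.abs_sub_left_of_mem_uIcc hz).trans hd
  induction m with
  | zero =>
    intro u hu h
    exact key u hu t ⟨hu.1.trans hu.2, le_rfl⟩ hu.2 (by simpa using h)
  | succ m ih =>
    intro u hu h
    push_cast at h
    set θ : ℝ := 1 / ((m:ℝ) + 2) with hθ
    have hm : (0:ℝ) < (m:ℝ) + 2 := by positivity
    have hθ0 : 0 < θ := by positivity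
    have hθ1 : θ ≤ 1 := by
      rw [hθ, div_le_one hm]; have : (0:ℝ) ≤ m := by positivity
      linarith
    have hθm : θ * (m + 2) = 1 := by rw [hθ]; field_simp
    have hmem : f u + θ * (f t - f u) ∈ Set.uIcc (f u) (f t) := by
      rw [Set.mem_uIcc]
      rcases le_total (f u) (f t) with h | h
      · left; constructor <;> nlinarith
      · right; constructor <;> nlinarith
    have hfc : ContinuousOn f (Set.uIcc u t) := by
      rw [Set.uIcc_of_le hu.2]
      exact hf.mono (Set.Icc_subset_Icc_left hu.1)
    obtain ⟨v, hv, hfv⟩ := intermediate_value_uIcc hfc hmem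
    rw [Set.uIcc_of_le hu.2] at hv
    have hvs : v ∈ Set.Icc s t := ⟨hu.1.trans hv.1, hv.2⟩
    have d1 : |f v - f u| = θ * |f t - f u| := by
      rw [hfv, add_sub_cancel_left, abs_mul, abs_of_pos hθ0]
    have d2 : |f t - f v| = (1 - θ) * |f t - f u| := by
      rw [hfv, ← abs_of_nonneg (sub_nonneg.2 hθ1), ← abs_mul]
      ring_nf
    have k1 := key u hu v hvs hv.1 (by
      rw [d1]
      calc θ * |f t - f u| ≤ θ * ((m + 1 + 1) * d) := by gcongr
        _ = (θ * (m + 2)) * d := by ring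
        _ = d := by rw [hθm, one_mul])
    have k2 := ih v hvs (by
      rw [d2]
      calc (1 - θ) * |f t - f u| ≤ (1 - θ) * ((m + 1 + 1) * d) := by
            have := sub_nonneg.2 hθ1
            gcongr
        _ = (m + 2) * d - (θ * (m + 2)) * d := by ring
        _ = (m + 1) * d := by rw [hθm]; ring)
    have : F (t, f t) - F (u, f u) - a * (f t - f u) - b * (t - u)
      = (F (t, f t) - F (v, f v) - a * (f t - f v) - b * (t - v))
        + (F (v, f v) - F (u, f u) - a * (f v - f u) - b * (v - u)) := by ring
    rw [this]
    refine (abs_add_le _ _).trans ((add_le_add k2 k1).trans (le_of_eq ?_))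
    rw [d1, d2]; ring

lemma yi_local (F : ℝ × ℝ → ℝ) (hF : ContDiff ℝ 1 F) (f : ℝ → ℝ) (a b A B s t : ℝ)
    (hst : s ≤ t) (hf : ContinuousOn f (Set.Icc s t))
    (h1 : ∀ u ∈ Set.Icc s t, |fderiv ℝ F (u, f u) (0, 1) - a| ≤ A)
    (h2 : ∀ u ∈ Set.Icc s t, ∀ v ∈ Set.Icc s t, |fderiv ℝ F (u, f v) (1, 0) - b| ≤ B) :
    |F (t, f t) - F (s, f s) - a * (f t - f s) - b * (t - s)|
      ≤ A * |f t - f s| + B * (t - s) := by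
  have hdc : Continuous (fun p : ℝ × ℝ => fderiv ℝ F p (0, 1)) :=
    (hF.continuous_fderiv one_ne_zero).clm_apply continuous_const
  have hcomp : ContinuousOn (fun p : ℝ × ℝ => fderiv ℝ F (p.1, f p.1 + p.2) (0, 1))
      (Set.Icc s t ×ˢ Set.Icc (-1) 1) := by
    refine hdc.comp_continuousOn (continuousOn_fst.prodMk (ContinuousOn.add ?_ continuousOn_snd))
    exact hf.comp continuousOn_fst (fun p hp => hp.1)
  have huc := (isCompact_Icc.prod isCompact_Icc).uniformContinuousOn_of_continuous hcomp
  rw [Metric.uniformContinuousOn_iff] at huc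
  refine le_of_forall_pos_le_add fun ε hε => ?_
  have hD : 0 < |f t - f s| + 1 := by positivity
  obtain ⟨δ, hδ, hu⟩ := huc (ε / (|f t - f s| + 1)) (by positivity)
  set d := min (δ / 2) 1 with hd
  have hd0 : 0 < d := by positivity
  obtain ⟨m, hm⟩ := exists_nat_gt (|f t - f s| / d)
  have := yi_chain F hF f a b (A + ε / (|f t - f s| + 1)) B s t d hf (fun u hu' z hz => by
      have hz1 : |z - f u| ≤ 1 := hz.trans (min_le_right _ _)
      have h3 := hu (u, z - f u) ⟨hu', abs_le.1 hz1⟩ (u, 0) ⟨hu', by simp⟩ (by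
        rw [Prod.dist_eq]
        simp only [dist_self, Real.dist_eq, sub_zero]
        rw [max_lt_iff]
        exact ⟨hδ, (hz.trans (min_le_left _ _)).trans_lt (by linarith)⟩)
      simp only [Real.dist_eq, add_sub_cancel, add_zero] at h3
      have h4 := abs_sub_le (fderiv ℝ F (u, z) (0, 1)) (fderiv ℝ F (u, f u) (0, 1)) a
      have := h1 u hu'
      linarith) h2 m s ⟨le_rfl, hst⟩ (by
        rw [div_lt_iff₀ hd0] at hm
        linarith)
  refine this.trans ?_
  have h5 : ε / (|f t - f s| + 1) * |f t - f s| ≤ ε := by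
    rw [div_mul_eq_mul_div, div_le_iff₀ hD]
    nlinarith
  linarith

/-- Itô (change–of–variables) formula for Young integrals: if `f` is `γ`-Hölder,
`F ∈ C¹([0,1] × ℝ)` and `s ↦ ∂ₓF(s, f(s))` is `α`-Hölder with `α + γ > 1`, and `I t` is
the Young integral of `s ↦ ∂ₓF(s, f(s))` against `f` over `[0,t]` (limit of left-endpoint
Riemann sums), then `F(t, f(t)) = F(0, f(0)) + I(t) + ∫₀ᵗ ∂ₛF(s, f(s)) ds`. -/
theorem young_ito_formula
    (α γ : ℝ) (hα : 0 < α) (hα1 : α ≤ 1) (hγ : 0 < γ) (hγ1 : γ ≤ 1)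
    (hαγ : 1 < α + γ)
    (f : ℝ → ℝ)
    (hf : ∃ K : ℝ, ∀ s ∈ Set.Icc (0:ℝ) 1, ∀ u ∈ Set.Icc (0:ℝ) 1,
      |f u - f s| ≤ K * |u - s| ^ γ)
    (F : ℝ × ℝ → ℝ) (hF : ContDiff ℝ 1 F)
    (hFx : ∃ K : ℝ, ∀ s ∈ Set.Icc (0:ℝ) 1, ∀ u ∈ Set.Icc (0:ℝ) 1,
      |fderiv ℝ F (u, f u) (0, 1) - fderiv ℝ F (s, f s) (0, 1)| ≤ K * |u - s| ^ α)
    (I : ℝ → ℝ)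
    (hI : ∀ t ∈ Set.Icc (0:ℝ) 1, ∀ η > 0, ∃ δ > 0, ∀ (n : ℕ) (pt : Fin (n + 1) → ℝ),
      StrictMono pt → pt 0 = 0 → pt (Fin.last n) = t →
      (∀ i : Fin n, pt i.succ - pt i.castSucc < δ) →
      |riemannSum (fun s => fderiv ℝ F (s, f s) (0, 1)) f n pt - I t| < η) :
    ∀ t ∈ Set.Icc (0:ℝ) 1,
      F (t, f t) = F (0, f 0) + I t + ∫ s in (0:ℝ)..t, fderiv ℝ F (s, f s) (1, 0) := by
  obtain ⟨K, hK⟩ := hf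
  obtain ⟨L, hL⟩ := hFx
  have hfc : ContinuousOn f (Set.Icc 0 1) := by
    intro s hs
    rw [ContinuousWithinAt, tendsto_iff_dist_tendsto_zero]
    have hc : Continuous (fun u : ℝ => K * |u - s| ^ γ) := by
      refine continuous_const.mul (Continuous.rpow_const (by fun_prop) (fun _ => Or.inr hγ.le))
    have h0 := (hc.tendsto s).mono_left (nhdsWithin_le_nhds (s := Set.Icc 0 1))
    simp only [sub_self, abs_zero, Real.zero_rpow hγ.ne', mul_zero] at h0
    refine squeeze_zero' (Filter.Eventually.of_forall fun _ => dist_nonneg) ?_ h0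
    filter_upwards [self_mem_nhdsWithin] with u hu
    exact hK s hs u hu
  have hdc : Continuous (fun p : ℝ × ℝ => fderiv ℝ F p (1, 0)) :=
    (hF.continuous_fderiv one_ne_zero).clm_apply continuous_const
  have hψ : ContinuousOn (fun s => fderiv ℝ F (s, f s) (1, 0)) (Set.Icc 0 1) :=
    hdc.comp_continuousOn (continuousOn_id.prodMk hfc)
  have hcomp : ContinuousOn (fun p : ℝ × ℝ => fderiv ℝ F (p.1, f p.2) (1, 0))
      (Set.Icc 0 1 ×ˢ Set.Icc 0 1) :=
    hdc.comp_continuousOn (continuousOn_fst.prodMk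
      (hfc.comp continuousOn_snd (fun p hp => hp.2)))
  have huc := (isCompact_Icc.prod isCompact_Icc).uniformContinuousOn_of_continuous hcomp
  rw [Metric.uniformContinuousOn_iff] at huc
  have hint : ∀ s ∈ Set.Icc (0:ℝ) 1, ∀ t ∈ Set.Icc (0:ℝ) 1,
      IntervalIntegrable (fun s => fderiv ℝ F (s, f s) (1, 0)) MeasureTheory.volume s t := by
    intro s hs t ht
    exact (hψ.mono (Set.uIcc_subset_Icc hs ht)).intervalIntegrable
  -- local estimate
  have hloc : ∀ ε > 0, ∃ δ > 0, ∀ s ∈ Set.Icc (0:ℝ) 1, ∀ t ∈ Set.Icc (0:ℝ) 1, s ≤ t → t - s < δ →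
      |F (t, f t) - F (s, f s) - fderiv ℝ F (s, f s) (0, 1) * (f t - f s)
        - ∫ r in s..t, fderiv ℝ F (r, f r) (1, 0)| ≤ ε * (t - s) := by
    intro ε hε
    obtain ⟨δ₁, hδ₁, hu⟩ := huc (ε / 3) (by positivity)
    have hpow : ∃ δ₂ > 0, ∀ x : ℝ, 0 ≤ x → x < δ₂ → |L| * |K| * x ^ (α + γ - 1) ≤ ε / 3 := by
      have hc : Continuous (fun x : ℝ => |L| * |K| * x ^ (α + γ - 1)) :=
        continuous_const.mul (Continuous.rpow_const continuous_id
          (fun _ => Or.inr (by linarith)))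
      have := Metric.continuous_iff.1 hc 0 (ε / 3) (by positivity)
      obtain ⟨δ, hδ, h⟩ := this
      refine ⟨δ, hδ, fun x hx hxδ => ?_⟩
      have := h x (by rw [Real.dist_eq, sub_zero, abs_of_nonneg hx]; exact hxδ)
      rw [Real.dist_eq, Real.zero_rpow (by linarith), mul_zero, sub_zero] at this
      exact (le_abs_self _).trans this.le
    obtain ⟨δ₂, hδ₂, hp⟩ := hpow
    refine ⟨min δ₁ δ₂, lt_min hδ₁ hδ₂, fun s hs t ht hst hd => ?_⟩
    have hd1 : t - s < δ₁ := hd.trans_le (min_le_left _ _)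
    have hd2 : t - s < δ₂ := hd.trans_le (min_le_right _ _)
    have hsub : Set.Icc s t ⊆ Set.Icc 0 1 := Set.Icc_subset_Icc hs.1 ht.2
    have hts : 0 ≤ t - s := sub_nonneg.2 hst
    have hB : ∀ u ∈ Set.Icc s t, ∀ v ∈ Set.Icc s t,
        |fderiv ℝ F (u, f v) (1, 0) - fderiv ℝ F (s, f s) (1, 0)| ≤ ε / 3 := by
      intro u hu' v hv
      refine (hu (u, v) ⟨hsub hu', hsub hv⟩ (s, s) ⟨hs, hs⟩ ?_).le
      rw [Prod.dist_eq, max_lt_iff, Real.dist_eq, Real.dist_eq,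
        abs_of_nonneg (sub_nonneg.2 hu'.1), abs_of_nonneg (sub_nonneg.2 hv.1)]
      exact ⟨by linarith [hu'.2], by linarith [hv.2]⟩
    have h1 := yi_local F hF f (fderiv ℝ F (s, f s) (0, 1)) (fderiv ℝ F (s, f s) (1, 0))
      (|L| * (t - s) ^ α) (ε / 3) s t hst (hfc.mono hsub) (fun u hu' => by
        refine (hL s hs u (hsub hu')).trans ?_
        rw [abs_of_nonneg (sub_nonneg.2 hu'.1)]
        have h0 : 0 ≤ u - s := sub_nonneg.2 hu'.1
        have : u - s ≤ t - s := by linarith [hu'.2]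
        calc L * (u - s) ^ α ≤ |L| * (u - s) ^ α := by
              gcongr; exact le_abs_self L
          _ ≤ _ := by gcongr) hB
    have h2 : |f t - f s| ≤ |K| * (t - s) ^ γ := by
      refine (hK s hs t ht).trans ?_
      rw [abs_of_nonneg hts]
      gcongr
      exact le_abs_self K
    have h3 : |L| * (t - s) ^ α * |f t - f s| ≤ ε / 3 * (t - s) := by
      calc |L| * (t - s) ^ α * |f t - f s| ≤ |L| * (t - s) ^ α * (|K| * (t - s) ^ γ) := by gcongr
        _ = |L| * |K| * (t - s) ^ (α + γ - 1) * (t - s) := by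
          rcases hts.eq_or_lt with h | h
          · rw [← h, Real.zero_rpow hα.ne']; ring
          · rw [Real.rpow_sub h, Real.rpow_add h, Real.rpow_one]; field_simp
        _ ≤ _ := by gcongr; exact hp _ hts hd2
    have h4 : |(∫ r in s..t, fderiv ℝ F (r, f r) (1, 0)) - fderiv ℝ F (s, f s) (1, 0) * (t - s)|
        ≤ ε / 3 * (t - s) := by
      have e : (∫ r in s..t, fderiv ℝ F (r, f r) (1, 0)) - fderiv ℝ F (s, f s) (1, 0) * (t - s)
          = ∫ r in s..t, (fderiv ℝ F (r, f r) (1, 0) - fderiv ℝ F (s, f s) (1, 0)) := by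
        rw [intervalIntegral.integral_sub (hint s hs t ht) (by simp),
          intervalIntegral.integral_const, smul_eq_mul, mul_comm]
      rw [e]
      have := intervalIntegral.norm_integral_le_of_norm_le_const (a := s) (b := t) (C := ε / 3)
        (f := fun r => fderiv ℝ F (r, f r) (1, 0) - fderiv ℝ F (s, f s) (1, 0)) (fun x hx => by
          rw [Set.uIoc_of_le hst] at hx
          exact hB x ⟨hx.1.le, hx.2⟩ x ⟨hx.1.le, hx.2⟩)
      rwa [abs_of_nonneg hts] at this
    rw [abs_le] at h1 h4 ⊢
    constructor <;> linarith [h1.1, h1.2, h4.1, h4.2]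
  intro t ht
  suffices h : |F (t, f t) - F (0, f 0) - I t - ∫ s in (0:ℝ)..t, fderiv ℝ F (s, f s) (1, 0)| ≤ 0 by
    have := abs_nonpos_iff.1 h
    linarith
  refine le_of_forall_pos_le_add fun ε hε => ?_
  obtain ⟨δ₁, hδ₁, hl⟩ := hloc (ε / 2) (by positivity)
  obtain ⟨δ₂, hδ₂, hr⟩ := hI t ht (ε / 2) (by positivity)
  have h0m : (0:ℝ) ∈ Set.Icc (0:ℝ) 1 := by simp
  rcases ht.1.eq_or_lt with rfl | ht0
  · have := hr 0 (fun _ => 0) (fun i j hij => by omega) rfl rfl (fun i => i.elim0)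
    simp only [riemannSum, Finset.univ_eq_empty, Finset.sum_empty] at this
    rw [intervalIntegral.integral_same]
    have e : F (0, f 0) - F (0, f 0) - I 0 - 0 = 0 - I 0 := by ring
    rw [e]
    linarith
  obtain ⟨n, hn⟩ := exists_nat_gt (t / min δ₁ δ₂)
  have hmin : 0 < min δ₁ δ₂ := lt_min hδ₁ hδ₂
  have hn0 : (0:ℝ) < n := lt_of_le_of_lt (by positivity) hn
  have hmesh : t / n < min δ₁ δ₂ := by
    rw [div_lt_iff₀ hmin] at hn
    rw [div_lt_iff₀ hn0]; linarith
  set p : ℕ → ℝ := fun k => k * (t / n) with hpdef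
  have htn : 0 < t / n := by positivity
  have hp0 : p 0 = 0 := by simp [hpdef]
  have hpn : p n = t := by simp only [hpdef]; field_simp
  have hps : ∀ k, p (k + 1) - p k = t / n := by intro k; simp only [hpdef]; push_cast; ring
  have hpm : StrictMono p := strictMono_nat_of_lt_succ fun k => by linarith [hps k]
  have hpI : ∀ k ≤ n, p k ∈ Set.Icc (0:ℝ) 1 := fun k hk =>
    ⟨hp0 ▸ hpm.monotone (Nat.zero_le k), (hpm.monotone hk).trans (hpn.le.trans ht.2)⟩
  have hR := hr n (fun i => p i) (fun i j hij => hpm hij) (by simpa using hp0) (by simpa using hpn)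
    (fun i => by
      simp only [Fin.val_succ, Fin.val_castSucc, hps]
      exact hmesh.trans_le (min_le_right _ _))
  have hsum : ∀ k ≤ n, |F (p k, f (p k)) - F (0, f 0)
      - (∑ i ∈ Finset.range k, fderiv ℝ F (p i, f (p i)) (0, 1) * (f (p (i + 1)) - f (p i)))
      - ∫ s in (0:ℝ)..(p k), fderiv ℝ F (s, f s) (1, 0)| ≤ ε / 2 * p k := by
    intro k
    induction k with
    | zero => intro _; simp [hp0]
    | succ k ih =>
      intro hk
      have hk' : k ≤ n := by omega
      have i1 := ih hk'
      have i2 := hl (p k) (hpI k hk') (p (k + 1)) (hpI _ hk) (hpm.monotone (Nat.le_succ k))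
        (by rw [hps]; exact hmesh.trans_le (min_le_left _ _))
      rw [Finset.sum_range_succ, ← intervalIntegral.integral_add_adjacent_intervals
        (hint 0 h0m _ (hpI k hk')) (hint _ (hpI k hk') _ (hpI _ hk))]
      rw [abs_le] at i1 i2 ⊢
      constructor <;> linarith [i1.1, i1.2, i2.1, i2.2]
  have hS := hsum n le_rfl
  have hRS : riemannSum (fun s => fderiv ℝ F (s, f s) (0, 1)) f n (fun i => p i)
      = ∑ i ∈ Finset.range n, fderiv ℝ F (p i, f (p i)) (0, 1) * (f (p (i + 1)) - f (p i)) := by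
    rw [riemannSum, Finset.sum_range]
    simp
  rw [hRS] at hR
  rw [hpn] at hS
  have : ε / 2 * t ≤ ε / 2 := by nlinarith [ht.2]
  rw [abs_lt] at hR
  rw [abs_le] at hS ⊢
  constructor <;> linarith [hR.1, hR.2, hS.1, hS.2]
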